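/- Let u : ℝ³ → ℝ³ be a bounded C² divergence-free vector field whose vorticity ω = curl u satisfies ω(x) = (0, 0, ω₃(x)) for all x (the first two components of ω vanish). Then u₃ is constant, and u₁, u₂ are independent of x₃. -/

import Mathlib

noncomputable def pd (i : Fin 3) (f : (Fin 3 → ℝ) → ℝ) (x : Fin 3 → ℝ) : ℝ :=
  fderiv ℝ f x (Pi.single i 1)

noncomputable def div3 (u : (Fin 3 → ℝ) → (Fin 3 → ℝ)) (x : Fin 3 → ℝ) : ℝ :=
  ∑ i : Fin 3, pd i (fun y => u y i) x

noncomputable def curl3 (u : (Fin 3 → ℝ) → (Fin 3 → ℝ)) (x : Fin 3 → ℝ) : Fin 3 → ℝ :=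
  ![pd 1 (fun y => u y 2) x - pd 2 (fun y => u y 1) x,
    pd 2 (fun y => u y 0) x - pd 0 (fun y => u y 2) x,
    pd 0 (fun y => u y 1) x - pd 1 (fun y => u y 0) x]

noncomputable def lap3 (f : (Fin 3 → ℝ) → ℝ) (x : Fin 3 → ℝ) : ℝ :=
  ∑ i : Fin 3, pd i (pd i f) x

lemma aux_max {φ φ' : ℝ → ℝ} {d : ℝ} (h1 : ∀ s, HasDerivAt φ (φ' s) s)
    (h2 : HasDerivAt φ' d 0) (hm : IsLocalMax φ 0) : d ≤ 0 := by
  by_contra! hd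
  have e1 : deriv φ = φ' := funext fun s => (h1 s).deriv
  have hmin : IsLocalMin φ 0 := by
    apply isLocalMin_of_deriv_deriv_pos
    · rw [e1, h2.deriv]; exact hd
    · exact hm.deriv_eq_zero
    · exact (h1 0).continuousAt
  have hc : φ =ᶠ[nhds 0] fun _ => φ 0 := by
    filter_upwards [hm, hmin] with s a b using le_antisymm a b
  have hc2 := hc.deriv.deriv_eq
  rw [e1, h2.deriv] at hc2
  simp at hc2
  linarith

lemma aux_pd_smooth {f : (Fin 3 → ℝ) → ℝ} (hf : ContDiff ℝ 2 f) (j : Fin 3) :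
    ContDiff ℝ 1 (pd j f) := by
  unfold pd
  exact (hf.fderiv_right (m := 1) (by norm_num)).clm_apply contDiff_const

lemma aux_line {f : (Fin 3 → ℝ) → ℝ} (hf : Differentiable ℝ f) (j : Fin 3) (ε : ℝ)
    (q : Fin 3 → ℝ) (s : ℝ) :
    HasDerivAt (fun s : ℝ => f (q + (s * ε) • Pi.single j 1))
      (ε * pd j f (q + (s * ε) • Pi.single j 1)) s := by
  have h : HasDerivAt (fun s : ℝ => q + (s * ε) • (Pi.single j 1 : Fin 3 → ℝ))
      (ε • (Pi.single j 1 : Fin 3 → ℝ)) s := by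
    have := ((hasDerivAt_id s).mul_const ε).smul_const (Pi.single j 1 : Fin 3 → ℝ)
    simpa using this.const_add q
  have := (hf _).hasFDerivAt.comp_hasDerivAt s h
  have e : ε * pd j f (q + (s * ε) • Pi.single j 1)
      = fderiv ℝ f (q + (s * ε) • Pi.single j 1) (ε • Pi.single j 1) := by simp [pd]
  rw [e]
  exact this

noncomputable def auxB (C R : ℝ) (i : Fin 3) (x : Fin 3 → ℝ) : ℝ :=
  C * ((∑ k, x k ^ 2) / R ^ 2 - 4 * x i ^ 2 / R ^ 2 + 4 * x i / R)

lemma auxB_line (C R : ℝ) (i j : Fin 3) (p : Fin 3 → ℝ) : ∃ B : ℝ, ∀ s : ℝ,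
    auxB C R i (p + (s * 1) • Pi.single j 1) =
      auxB C R i p + s * B + s ^ 2 * (C * (1 - 4 * (if i = j then 1 else 0)) / R ^ 2) := by
  refine ⟨C * (2 * p j / R ^ 2 + (if i = j then 1 else 0) * (-8 * p i / R ^ 2 + 4 / R)), ?_⟩
  intro s
  fin_cases i <;> fin_cases j <;> simp [auxB, Fin.sum_univ_three] <;> ring

noncomputable def auxR (i : Fin 3) (x : Fin 3 → ℝ) : Fin 3 → ℝ :=
  fun k => (if k = i then -1 else 1) * x k

lemma aux_bound {f : (Fin 3 → ℝ) → ℝ} (hf : ContDiff ℝ 2 f) (hl : ∀ x, lap3 f x = 0)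
    {C : ℝ} (hC : 0 < C) (hb : ∀ x y, f x - f y ≤ C) (i : Fin 3) {R : ℝ} (hR : 0 < R)
    {x : Fin 3 → ℝ} (hx : ∀ k, x k ∈ Set.Icc (-R) R) (hxi : 0 ≤ x i) :
    f x - f (auxR i x) ≤ auxB C R i x := by
  let G : (Fin 3 → ℝ) → ℝ := fun x => f x - f (auxR i x) - auxB C R i x
  let K : Set (Fin 3 → ℝ) := {x | (∀ k, x k ∈ Set.Icc (-R) R) ∧ 0 ≤ x i}
  have hK : IsCompact K := by
    have : K = Set.pi Set.univ (fun _ => Set.Icc (-R) R) ∩ {x | 0 ≤ x i} := by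
      ext x; simp only [K, Set.mem_setOf_eq, Set.mem_inter_iff, Set.mem_univ_pi]
    rw [this]
    exact (isCompact_univ_pi fun _ => isCompact_Icc).inter_right
      (isClosed_le continuous_const (continuous_apply i))
  have hcf := hf.continuous
  have hcR : Continuous (auxR i) := by unfold auxR; fun_prop
  have hcB : Continuous (auxB C R i) := by unfold auxB; fun_prop
  have hG : Continuous G := by fun_prop
  obtain ⟨p, hp, hmax⟩ := hK.exists_isMaxOn ⟨x, hx, hxi⟩ hG.continuousOn
  suffices G p ≤ 0 by
    have h1 : G x ≤ G p := hmax (show x ∈ K from ⟨hx, hxi⟩)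
    have : G x ≤ 0 := h1.trans this
    simp only [G] at this
    linarith
  have hBeq : auxB C R i p = C * ((∑ k ∈ Finset.univ.erase i, (p k / R) ^ 2)
      + (p i / R) * (4 - 3 * (p i / R))) := by
    unfold auxB
    rw [← Finset.add_sum_erase _ _ (Finset.mem_univ i)]
    simp only [div_pow, ← Finset.sum_div]
    field_simp
    ring
  have ht0 : 0 ≤ p i / R := div_nonneg hp.2 hR.le
  have ht1 : p i / R ≤ 1 := (div_le_one hR).2 (hp.1 i).2
  have hs0 : 0 ≤ ∑ k ∈ Finset.univ.erase i, (p k / R) ^ 2 :=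
    Finset.sum_nonneg fun _ _ => sq_nonneg _
  have htt : 0 ≤ (p i / R) * (4 - 3 * (p i / R)) := mul_nonneg ht0 (by linarith)
  by_cases c1 : p i = 0
  · have : auxR i p = p := by
      ext k; unfold auxR; split_ifs with h
      · subst h; simp [c1]
      · simp
    simp only [G, this, hBeq]
    have : 0 ≤ C * ((∑ k ∈ Finset.univ.erase i, (p k / R) ^ 2)
      + (p i / R) * (4 - 3 * (p i / R))) := by positivity
    linarith
  by_cases c2 : ∃ k, p k = R ∨ p k = -R
  · obtain ⟨k, hk⟩ := c2
    have : 1 ≤ (∑ k ∈ Finset.univ.erase i, (p k / R) ^ 2)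
      + (p i / R) * (4 - 3 * (p i / R)) := by
      by_cases hki : k = i
      · subst hki
        rcases hk with hk | hk
        · rw [hk] at *
          rw [div_self hR.ne'] at *
          linarith
        · have := hp.2; linarith
      · have h1 : (p k / R) ^ 2 = 1 := by
          rcases hk with hk | hk <;> rw [hk] <;> field_simp
        have := Finset.single_le_sum (f := fun k => (p k / R) ^ 2) (fun _ _ => sq_nonneg _)
          (Finset.mem_erase.2 ⟨hki, Finset.mem_univ k⟩)
        simp only [h1] at this
        linarith
    have h2 := mul_le_mul_of_nonneg_left this hC.le
    have h3 := hb p (auxR i p)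
    simp only [G, hBeq]
    linarith
  exfalso
  push Not at c2
  have hnhds : K ∈ nhds p := by
    have h1 : ∀ᶠ y in nhds p, ∀ k, y k ∈ Set.Ioo (-R) R := by
      rw [Filter.eventually_all]
      intro k
      apply (continuous_apply k).continuousAt.eventually_mem
      exact Ioo_mem_nhds (lt_of_le_of_ne (hp.1 k).1 (c2 k).2.symm)
        (lt_of_le_of_ne (hp.1 k).2 (c2 k).1)
    have h2 : ∀ᶠ y in nhds p, y i ∈ Set.Ioi 0 :=
      (continuous_apply i).continuousAt.eventually_mem
        (Ioi_mem_nhds (lt_of_le_of_ne hp.2 (Ne.symm c1)))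
    filter_upwards [h1, h2] with y a b
    exact ⟨fun k => ⟨(a k).1.le, (a k).2.le⟩, le_of_lt b⟩
  have hloc : IsLocalMax G p := hmax.isLocalMax hnhds
  have key : ∀ j, pd j (pd j f) p - pd j (pd j f) (auxR i p)
      - 2 * (C * (1 - 4 * (if i = j then 1 else 0)) / R ^ 2) ≤ 0 := by
    intro j
    obtain ⟨B, hB⟩ := auxB_line C R i j p
    set Q := (C * (1 - 4 * (if i = j then 1 else 0)) / R ^ 2) with hQ
    set ε : ℝ := if j = i then -1 else 1 with hε
    have hεε : ε * ε = 1 := by rw [hε]; split_ifs <;> norm_num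
    have hrl : ∀ s : ℝ, auxR i (p + (s * 1) • Pi.single j 1)
        = auxR i p + (s * ε) • Pi.single j 1 := by
      intro s
      ext k
      by_cases hkj : k = j
      · subst hkj
        simp only [auxR, Pi.add_apply, Pi.smul_apply, Pi.single_eq_same, smul_eq_mul, ← hε]; ring
      · simp [auxR, hkj]
    have hfd : Differentiable ℝ f := hf.differentiable (by norm_num)
    have hpd : Differentiable ℝ (pd j f) := (aux_pd_smooth hf j).differentiable (by norm_num)
    have hquad : ∀ s : ℝ, HasDerivAt (fun s => auxB C R i p + s * B + s ^ 2 * Q)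
        (B + 2 * s * Q) s := by
      intro s
      have := (((hasDerivAt_id s).mul_const B).const_add (auxB C R i p)).add
        (((hasDerivAt_id s).pow 2).mul_const Q)
      have e : B + 2 * s * Q = 1 * B + ((2 : ℕ) * (id s) ^ (2 - 1) * 1) * Q := by simp
      rw [e]
      exact this
    have h1 : ∀ s : ℝ, HasDerivAt (fun s : ℝ => G (p + (s * 1) • Pi.single j 1))
        (1 * pd j f (p + (s * 1) • Pi.single j 1)
          - ε * pd j f (auxR i p + (s * ε) • Pi.single j 1) - (B + 2 * s * Q)) s := by
      intro s
      have := ((aux_line hfd j 1 p s).sub (aux_line hfd j ε (auxR i p) s)).sub (hquad s)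
      have e : (fun s : ℝ => G (p + (s * 1) • Pi.single j 1)) =
          (((fun s => f (p + (s * 1) • Pi.single j 1)) -
            fun s => f (auxR i p + (s * ε) • Pi.single j 1)) - fun s =>
            auxB C R i p + s * B + s ^ 2 * Q) := by
        funext s
        simp only [G, hrl, hB, Pi.sub_apply]
      rw [e]
      exact this
    have h2 := (((aux_line hpd j 1 p 0).const_mul 1).sub
      ((aux_line hpd j ε (auxR i p) 0).const_mul ε)).sub
      ((((hasDerivAt_id (0:ℝ)).const_mul 2).mul_const Q).const_add B)
    have h3 : IsLocalMax (fun s : ℝ => G (p + (s * 1) • Pi.single j 1)) 0 := by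
      have hc : ContinuousAt (fun s : ℝ => p + (s * 1) • (Pi.single j 1 : Fin 3 → ℝ)) 0 := by
        fun_prop
      have ht : Filter.Tendsto (fun s : ℝ => p + (s * 1) • (Pi.single j 1 : Fin 3 → ℝ))
          (nhds 0) (nhds p) := by
        have := hc.tendsto
        simpa using this
      have := ht.eventually hloc
      filter_upwards [this] with s hs
      simpa using hs
    have := aux_max h1 h2 h3
    simp only [zero_mul, zero_smul, add_zero, ← mul_assoc, hεε] at this
    linarith
  have e1 := hl p
  have e2 := hl (auxR i p)
  have k0 := key 0
  have k1 := key 1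
  have k2 := key 2
  simp only [lap3, Fin.sum_univ_three] at e1 e2
  have hpos : 0 < C / R ^ 2 := by positivity
  simp only [mul_div_right_comm] at k0 k1 k2
  fin_cases i <;> simp at k0 k1 k2 e2 <;> linarith

lemma aux_le {f : (Fin 3 → ℝ) → ℝ} (hf : ContDiff ℝ 2 f) (hl : ∀ x, lap3 f x = 0)
    {C : ℝ} (hC : 0 < C) (hb : ∀ x y, f x - f y ≤ C) (i : Fin 3) {t : ℝ} (ht : 0 ≤ t) :
    f (t • Pi.single i 1) ≤ f (-(t • Pi.single i 1)) := by
  have hr : auxR i (t • Pi.single i 1) = -(t • Pi.single i 1) := by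
    ext k
    by_cases h : k = i
    · subst h; simp [auxR]
    · simp [auxR, h]
  have h1 : ∀ R : ℝ, 0 < R → t ≤ R →
      f (t • Pi.single i 1) - f (-(t • Pi.single i 1)) ≤ (4 * C * t) / R := by
    intro R hR htR
    have := aux_bound hf hl hC hb i hR (x := t • Pi.single i 1) (by
      intro k
      by_cases h : k = i
      · subst h; simp; constructor <;> linarith
      · simp [h, hR.le]) (by simpa using ht)
    rw [hr] at this
    refine this.trans ?_
    have e : auxB C R i (t • Pi.single i 1) = 4 * C * t / R - 3 * C * (t / R) ^ 2 := by
      fin_cases i <;> simp [auxB, Fin.sum_univ_three] <;> ring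
    rw [e]
    have : 0 ≤ 3 * C * (t / R) ^ 2 := by positivity
    linarith
  have h2 : Filter.Tendsto (fun R : ℝ => (4 * C * t) / R) Filter.atTop (nhds 0) :=
    tendsto_const_nhds.div_atTop Filter.tendsto_id
  have := ge_of_tendsto h2 (b := f (t • Pi.single i 1) - f (-(t • Pi.single i 1))) (by
    filter_upwards [Filter.eventually_gt_atTop 0, Filter.eventually_ge_atTop t] with R a b
    exact h1 R a b)
  linarith

lemma pd_shift (f : (Fin 3 → ℝ) → ℝ) (a : Fin 3 → ℝ) (j : Fin 3) :
    pd j (fun x => f (x + a)) = fun x => pd j f (x + a) := by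
  funext x
  simp [pd, fderiv_comp_add_right]

lemma pd_neg' (f : (Fin 3 → ℝ) → ℝ) (j : Fin 3) :
    pd j (fun x => - f x) = fun x => - pd j f x := by
  funext x
  simp [pd, fderiv_fun_neg]

lemma aux_step {f : (Fin 3 → ℝ) → ℝ} (hf : ContDiff ℝ 2 f) (hl : ∀ x, lap3 f x = 0)
    {C : ℝ} (hC : 0 < C) (hb : ∀ x y, f x - f y ≤ C) (i : Fin 3) (a : Fin 3 → ℝ)
    {t : ℝ} (ht : 0 ≤ t) :
    f (t • Pi.single i 1 + a) = f (-(t • Pi.single i 1) + a) := by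
  apply le_antisymm
  · refine aux_le (f := fun x => f (x + a)) (hf.comp (contDiff_id.add contDiff_const)) ?_ hC
      (fun x y => hb _ _) i ht
    intro x
    simp only [lap3, pd_shift]
    exact hl (x + a)
  · have := aux_le (f := fun x => - f (x + a)) (hf.comp (contDiff_id.add contDiff_const)).neg ?_ hC
      (fun x y => by linarith [hb (y + a) (x + a)]) i ht
    · linarith
    intro x
    simp only [lap3, pd_shift, pd_neg']
    have := hl (x + a)
    simp only [lap3] at this
    simp [this]

lemma aux_step2 {f : (Fin 3 → ℝ) → ℝ} (hf : ContDiff ℝ 2 f) (hl : ∀ x, lap3 f x = 0)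
    {C : ℝ} (hC : 0 < C) (hb : ∀ x y, f x - f y ≤ C) (i : Fin 3) (a : Fin 3 → ℝ) (t : ℝ) :
    f (a + t • Pi.single i 1) = f a := by
  have key : ∀ (a : Fin 3 → ℝ) (t : ℝ), 0 ≤ t → f (a + t • Pi.single i 1) = f a := by
    intro a t ht
    have := aux_step hf hl hC hb i (a + (t / 2) • Pi.single i 1) (t := t / 2) (by linarith)
    convert this using 2
    · ext k; simp; ring
    · ext k; simp
  rcases le_total 0 t with h | h
  · exact key a t h
  · have := key (a + t • Pi.single i 1) (-t) (by linarith)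
    rw [← this]; congr 1; ext k; simp

lemma aux_const {f : (Fin 3 → ℝ) → ℝ} (hf : ContDiff ℝ 2 f) (hl : ∀ x, lap3 f x = 0)
    {C : ℝ} (hC : 0 < C) (hb : ∀ x y, f x - f y ≤ C) (x : Fin 3 → ℝ) : f x = f 0 := by
  rw [← aux_step2 hf hl hC hb 0 0 (x 0),
    ← aux_step2 hf hl hC hb 1 (0 + x 0 • Pi.single 0 1) (x 1),
    ← aux_step2 hf hl hC hb 2 (0 + x 0 • Pi.single 0 1 + x 1 • Pi.single 1 1) (x 2)]
  congr 1
  ext k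
  fin_cases k <;> simp

lemma pd_comm {f : (Fin 3 → ℝ) → ℝ} (hf : ContDiff ℝ 2 f) (i j : Fin 3) (x : Fin 3 → ℝ) :
    pd i (pd j f) x = pd j (pd i f) x := by
  have hd : DifferentiableAt ℝ (fderiv ℝ f) x :=
    (hf.fderiv_right (m := 1) (by norm_num)).differentiable (by norm_num) x
  have e : ∀ i j : Fin 3, pd i (pd j f) x
      = fderiv ℝ (fderiv ℝ f) x (Pi.single i 1) (Pi.single j 1) := by
    intro i j
    have : pd j f = fun y => fderiv ℝ f y (Pi.single j 1) := rfl
    rw [this, pd, fderiv_clm_apply hd (differentiableAt_const _)]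
    simp
  rw [e, e]
  exact (hf.contDiffAt.isSymmSndFDerivAt (by simp)) _ _

/-- if a bounded C² divergence-free field on ℝ³ has vorticity of the form
`ω = (0,0,ω₃)`, then `u₃` is constant and `u₁, u₂` do not depend on `x₃`. -/
theorem vertical_vorticity_structure (u : (Fin 3 → ℝ) → (Fin 3 → ℝ))
    (hu : ContDiff ℝ 2 u) (hbdd : ∃ M, ∀ x, ‖u x‖ ≤ M)
    (hdiv : ∀ x, div3 u x = 0)
    (hω : ∀ x, curl3 u x 0 = 0 ∧ curl3 u x 1 = 0) :
    (∀ x y, u x 2 = u y 2) ∧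
    (∀ x, pd 2 (fun y => u y 0) x = 0 ∧ pd 2 (fun y => u y 1) x = 0) := by
  have hc : ∀ i : Fin 3, ContDiff ℝ 2 (fun y => u y i) := fun i => contDiff_pi.1 hu i
  obtain ⟨M, hM⟩ := hbdd
  have h0 : pd 1 (fun y => u y 2) = pd 2 (fun y => u y 1) := by
    funext x
    have := (hω x).1
    simp [curl3] at this
    linarith
  have h1 : pd 0 (fun y => u y 2) = pd 2 (fun y => u y 0) := by
    funext x
    have := (hω x).2
    simp [curl3] at this
    linarith
  have hl : ∀ x, lap3 (fun y => u y 2) x = 0 := by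
    intro x
    simp only [lap3, Fin.sum_univ_three]
    rw [h0, h1, pd_comm (hc 0), pd_comm (hc 1)]
    have hd : div3 u = fun _ => 0 := funext hdiv
    have hz : pd 2 (div3 u) x = 0 := by rw [hd]; simp [pd]
    have hdf : ∀ i : Fin 3, DifferentiableAt ℝ (pd i (fun y => u y i)) x := fun i =>
      (aux_pd_smooth (hc i) i).differentiable (by norm_num) x
    rw [← hz]
    have e : div3 u = (pd 0 (fun y => u y 0) + pd 1 (fun y => u y 1)) + pd 2 (fun y => u y 2) := by
      funext y
      simp [div3, Fin.sum_univ_three]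
    rw [e]
    conv_rhs => rw [pd, fderiv_add ((hdf 0).add (hdf 1)) (hdf 2), fderiv_add (hdf 0) (hdf 1)]
    simp [pd]
  have hM0 : 0 ≤ M := (norm_nonneg _).trans (hM 0)
  have hconst := aux_const (hc 2) hl (C := 2 * M + 1) (by linarith) (by
    intro x y
    have a := abs_le.1 ((norm_le_pi_norm (u x) 2).trans (hM x))
    have b := abs_le.1 ((norm_le_pi_norm (u y) 2).trans (hM y))
    linarith [a.2, b.1])
  refine ⟨fun x y => (hconst x).trans (hconst y).symm, fun x => ?_⟩
  have hf : (fun y => u y 2) = fun _ => u 0 2 := funext hconst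
  rw [← h0, ← h1, hf]
  simp [pd]
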